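/- arXiv:2308.01504 — 2 statements merged into one kernel-verified Lean document; each statement's English description precedes it below -/
import Mathlib

section
/- Let q be an odd prime power and let G₁ = 𝔽_q² ⋊ SL₂(𝔽_q), where SL₂(𝔽_q) acts on 𝔽_q² by matrix–vector multiplication. Then every nontrivial irreducible complex representation of G₁ has degree at least (q−1)/2; that is, G₁ is (q−1)/2-quasirandom. -/
open Matrix

/-- The action of `SL₂(F)` on `F²` by matrix-vector multiplication, as a homomorphism
into the automorphisms of the (multiplicative version of the) additive group `F²`. -/
def slHom (F : Type) [Field F] :
    Matrix.SpecialLinearGroup (Fin 2) F →* MulAut (Multiplicative (Fin 2 → F)) where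
  toFun h :=
    { toFun := fun v =>
        Multiplicative.ofAdd ((h : Matrix (Fin 2) (Fin 2) F).mulVec v.toAdd)
      invFun := fun v =>
        Multiplicative.ofAdd
          ((((h⁻¹ : Matrix.SpecialLinearGroup (Fin 2) F) :
            Matrix (Fin 2) (Fin 2) F)).mulVec v.toAdd)
      left_inv := fun v => by
        simp only [toAdd_ofAdd, Matrix.mulVec_mulVec,
          ← Matrix.SpecialLinearGroup.coe_mul, inv_mul_cancel,
          Matrix.SpecialLinearGroup.coe_one, Matrix.one_mulVec, ofAdd_toAdd]
      right_inv := fun v => by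
        simp only [toAdd_ofAdd, Matrix.mulVec_mulVec,
          ← Matrix.SpecialLinearGroup.coe_mul, mul_inv_cancel,
          Matrix.SpecialLinearGroup.coe_one, Matrix.one_mulVec, ofAdd_toAdd]
      map_mul' := fun u v => by
        simp only [toAdd_mul, Matrix.mulVec_add, ofAdd_add] }
  map_one' := by
    ext v
    simp [Matrix.one_mulVec]
  map_mul' h₁ h₂ := by
    ext v
    simp only [MulEquiv.coe_mk, Equiv.coe_fn_mk, MulAut.mul_apply, toAdd_ofAdd,
      Matrix.mulVec_mulVec, Matrix.SpecialLinearGroup.coe_mul]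

/-- The group `G₁ = F² ⋊ SL₂(F)` of area-preserving affine maps of the plane. -/
abbrev G1 (F : Type) [Field F] : Type :=
  Multiplicative (Fin 2 → F) ⋊[slHom F] Matrix.SpecialLinearGroup (Fin 2) F

/-- A representation is irreducible if the space is nontrivial and the only
invariant subspaces are `⊥` and `⊤`. -/
def IsIrreducibleRep {G V : Type*} [Group G] [AddCommGroup V] [Module ℂ V]
    (ρ : Representation ℂ G V) : Prop :=
  Nontrivial V ∧ ∀ W : Submodule ℂ V, (∀ g : G, ∀ v ∈ W, ρ g v ∈ W) → W = ⊥ ∨ W = ⊤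

open scoped MatrixGroups

section Eigenvectors

variable {A V : Type*} [AddCommGroup A] [AddCommGroup V] [Module ℂ V]

/-- A nontrivial complex representation of a finite abelian group has an eigenvector with a
nontrivial character. -/
theorem exists_eigenvector_of_ne_one [Finite A] (σ : Representation ℂ (Multiplicative A) V)
    {x : A} (hx : σ (.ofAdd x) ≠ 1) :
    ∃ ψ : AddChar A ℂ, ψ ≠ 1 ∧ ∃ w : V, w ≠ 0 ∧ ∀ b, σ (.ofAdd b) w = ψ b • w := by
  classical
  have := Fintype.ofFinite A
  by_contra! H
  let P (ψ : AddChar A ℂ) (v : V) : V := ∑ b, ψ (-b) • σ (.ofAdd b) v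
  have hP (ψ : AddChar A ℂ) (v : V) (b : A) : σ (.ofAdd b) (P ψ v) = ψ b • P ψ v := by
    simp only [P, map_sum, map_smul, Finset.smul_sum, smul_smul, ← AddChar.map_add_eq_mul]
    refine Fintype.sum_equiv (Equiv.addLeft b) _ _ fun c => ?_
    rw [← Module.End.mul_apply, ← map_mul, ← ofAdd_add]
    simp
  have hzero (ψ : AddChar A ℂ) (hψ : ψ ≠ 1) (v : V) : P ψ v = 0 := by
    by_contra hv
    obtain ⟨b, hb⟩ := H ψ hψ _ hv
    exact hb (hP ψ v b)
  have hsum (v : V) : ∑ ψ, P ψ v = (Fintype.card A : ℂ) • v := by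
    simp only [P]
    rw [Finset.sum_comm]
    simp [← Finset.sum_smul, AddChar.sum_apply_eq_ite, ite_smul]
  apply hx
  ext v
  have hone : P 1 v = (Fintype.card A : ℂ) • v := by
    rw [← hsum, Finset.sum_eq_single 1 (fun ψ _ hψ => hzero ψ hψ v) (by simp)]
  have h := hP 1 v x
  rw [hone, map_smul, AddChar.one_apply, one_smul] at h
  exact smul_right_injective V (Nat.cast_ne_zero.mpr Fintype.card_ne_zero) h

/-- Eigenvectors of a finite abelian group with pairwise distinct characters are linearly
independent. -/
theorem linearIndependent_of_eigenvectors [Finite A] {ι : Type*}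
    (σ : Representation ℂ (Multiplicative A) V) (χ : ι → AddChar A ℂ)
    (hχ : Function.Injective χ) (w : ι → V) (hw : ∀ i, w i ≠ 0)
    (h : ∀ i b, σ (.ofAdd b) (w i) = χ i b • w i) : LinearIndependent ℂ w := by
  rw [linearIndependent_iff']
  intro s c hc i hi
  have hdual (f : Module.Dual ℂ V) : c i * f (w i) = 0 := by
    have hli := (AddChar.linearIndependent A ℂ).comp χ hχ
    refine linearIndependent_iff'.mp hli s (fun j => c j * f (w j)) ?_ i hi
    ext b
    have hb := congrArg (fun v => f (σ (.ofAdd b) v)) hc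
    simp only [map_sum, map_smul, h, map_zero, smul_eq_mul] at hb
    simp only [Finset.sum_apply, Pi.smul_apply, Function.comp_apply, smul_eq_mul, Pi.zero_apply]
    rw [← hb]
    exact Finset.sum_congr rfl fun j _ => by ring
  have hci : c i • w i = 0 := by
    rw [← Module.forall_dual_apply_eq_zero_iff ℂ]
    intro f
    simpa using hdual f
  exact (smul_eq_zero.mp hci).resolve_right (hw i)

end Eigenvectors

section SpecialLinear

variable {F : Type*} [Field F]

/-- The upper unitriangular matrices, as a homomorphism from the additive group of the field. -/
def upperUnipotent (F : Type*) [Field F] : Multiplicative F →* SL(2, F) where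
  toFun b := ⟨!![1, b.toAdd; 0, 1], by simp⟩
  map_one' := by ext i j; fin_cases i <;> fin_cases j <;> simp
  map_mul' x y := by
    apply Subtype.ext
    change !![1, x.toAdd + y.toAdd; 0, 1] = !![1, x.toAdd; 0, 1] * !![1, y.toAdd; 0, 1]
    simp [add_comm]

theorem coe_upperUnipotent (b : F) :
    (upperUnipotent F (.ofAdd b) : Matrix (Fin 2) (Fin 2) F) = !![1, b; 0, 1] := rfl

/-- The diagonal matrix with entries `a⁻¹` and `a`. -/
def diagTorus (a : Fˣ) : SL(2, F) := ⟨!![(a : F)⁻¹, 0; 0, a], by simp⟩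

theorem coe_diagTorus (a : Fˣ) :
    (diagTorus a : Matrix (Fin 2) (Fin 2) F) = !![(a : F)⁻¹, 0; 0, a] := rfl

theorem upperUnipotent_mul_diagTorus (a : Fˣ) (b : F) :
    upperUnipotent F (.ofAdd b) * diagTorus a =
      diagTorus a * upperUnipotent F (.ofAdd ((a : F) ^ 2 * b)) := by
  apply Subtype.ext
  simp only [Matrix.SpecialLinearGroup.coe_mul, coe_upperUnipotent, coe_diagTorus,
    Matrix.mul_fin_two]
  ext i j
  fin_cases i <;> fin_cases j <;> simp
  field_simp

/-- `SL₂(F)` is the normal closure of its upper unitriangular matrices. -/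
theorem normal_eq_top_of_upperUnipotent_mem (N : Subgroup SL(2, F)) [hN : N.Normal]
    (hU : ∀ b : F, upperUnipotent F (.ofAdd b) ∈ N) : N = ⊤ := by
  let lower (c : F) : SL(2, F) := ⟨!![1, 0; c, 1], by simp⟩
  have coe_lower (c : F) : (lower c : Matrix (Fin 2) (Fin 2) F) = !![1, 0; c, 1] := rfl
  have hlower (c : F) : lower c ∈ N := by
    let s : SL(2, F) := ⟨!![0, 1; -1, 0], by simp⟩
    have coe_s : (s : Matrix (Fin 2) (Fin 2) F) = !![0, 1; -1, 0] := rfl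
    have hs : lower c = s * upperUnipotent F (.ofAdd (-c)) * s⁻¹ := by
      rw [eq_mul_inv_iff_mul_eq]
      apply Subtype.ext
      simp only [Matrix.SpecialLinearGroup.coe_mul, coe_upperUnipotent, coe_lower, coe_s,
        Matrix.mul_fin_two]
      simp
    rw [hs]
    exact hN.conj_mem _ (hU _) _
  have hne (g : SL(2, F)) (hg : g 1 0 ≠ 0) : g ∈ N := by
    have hdet : g 0 0 * g 1 1 - g 0 1 * g 1 0 = 1 := by
      rw [← Matrix.det_fin_two]; exact g.det_coe
    have hfac : g = upperUnipotent F (.ofAdd ((g 0 0 - 1) / g 1 0)) * lower (g 1 0) *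
        upperUnipotent F (.ofAdd ((g 1 1 - 1) / g 1 0)) := by
      apply Subtype.ext
      simp only [Matrix.SpecialLinearGroup.coe_mul, coe_upperUnipotent, coe_lower,
        Matrix.mul_fin_two]
      ext i j
      fin_cases i <;> fin_cases j <;> simp <;> field_simp
      · ring
      · linear_combination -hdet
      · ring
    rw [hfac]
    exact N.mul_mem (N.mul_mem (hU _) (hlower _)) (hU _)
  rw [Subgroup.eq_top_iff']
  intro g
  by_cases hg : g 1 0 = 0
  · rw [← N.mul_mem_cancel_right (hlower 1)]
    apply hne
    have hdet : g 0 0 * g 1 1 - g 0 1 * g 1 0 = 1 := by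
      rw [← Matrix.det_fin_two]; exact g.det_coe
    have h11 : g 1 1 ≠ 0 := by
      rintro h
      simp [h, hg] at hdet
    rw [Matrix.SpecialLinearGroup.coe_mul, coe_lower, Matrix.mul_apply]
    simpa [hg] using h11
  · exact hne g hg

end SpecialLinear

/-- A field with `q` elements has at least `(q - 1) / 2` nonzero squares. -/
theorem card_sub_one_le_two_mul_card_range_sq (F : Type*) [Field F] [Fintype F] :
    Fintype.card F - 1 ≤ 2 * Nat.card (Set.range fun a : Fˣ => (a : F) ^ 2) := by
  classical
  have h := Finset.card_le_mul_card_image (s := (Finset.univ : Finset Fˣ))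
    (f := fun a : Fˣ => (a : F) ^ 2) 2 fun c hc => by
      obtain ⟨a, -, rfl⟩ := Finset.mem_image.mp hc
      refine (Finset.card_le_card (t := {a, -a}) fun b hb => ?_).trans Finset.card_le_two
      have hb' := (Finset.mem_filter.mp hb).2
      rcases sq_eq_sq_iff_eq_or_eq_neg.mp hb' with h | h
      · simp [Units.ext h]
      · simp [show b = -a from Units.ext (by simpa using h)]
  rw [Finset.card_univ, Fintype.card_units] at h
  rwa [Nat.card_coe_set_eq, ← Set.image_univ, ← Finset.coe_univ, ← Finset.coe_image,
    Set.ncard_coe_finset]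

/-- `F² ⋊ SL₂(F)` is the normal closure of the upper unitriangular matrices in `SL₂(F)`. -/
theorem normal_eq_top_of_inr_upperUnipotent_mem {F : Type} [Field F] (N : Subgroup (G1 F))
    [hN : N.Normal]
    (hU : ∀ b : F, (SemidirectProduct.inr (upperUnipotent F (.ofAdd b)) : G1 F) ∈ N) :
    N = ⊤ := by
  have hinr (h : SL(2, F)) : (SemidirectProduct.inr h : G1 F) ∈ N := by
    have htop := normal_eq_top_of_upperUnipotent_mem
      (N.comap (SemidirectProduct.inr : SL(2, F) →* G1 F)) hU
    exact Subgroup.mem_comap.mp (htop ▸ Subgroup.mem_top h)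
  have hcomm (h : SL(2, F)) (z : Multiplicative (Fin 2 → F)) :
      (SemidirectProduct.inl (z * (slHom F h z)⁻¹) : G1 F) ∈ N := by
    have hz : (SemidirectProduct.inl (z * (slHom F h z)⁻¹) : G1 F) =
        SemidirectProduct.inl z * SemidirectProduct.inr h * (SemidirectProduct.inl z)⁻¹ *
          (SemidirectProduct.inr h)⁻¹ := by
      rw [map_mul, map_inv, SemidirectProduct.inl_aut]
      simp [mul_assoc]
    rw [hz]
    exact N.mul_mem (hN.conj_mem _ (hinr h) _) (N.inv_mem (hinr h))
  have hinl (z : Multiplicative (Fin 2 → F)) : (SemidirectProduct.inl z : G1 F) ∈ N := by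
    let u : SL(2, F) := upperUnipotent F (.ofAdd 1)
    let l : SL(2, F) := ⟨!![1, 0; 1, 1], by simp⟩
    have hz : z =
        (.ofAdd ![0, -z.toAdd 0] * (slHom F u (.ofAdd ![0, -z.toAdd 0]))⁻¹) *
        (.ofAdd ![-z.toAdd 1, 0] * (slHom F l (.ofAdd ![-z.toAdd 1, 0]))⁻¹) := by
      apply Multiplicative.toAdd.injective
      ext i
      fin_cases i <;> simp [slHom, u, l, coe_upperUnipotent]
    rw [hz, map_mul]
    exact N.mul_mem (hcomm _ _) (hcomm _ _)
  rw [Subgroup.eq_top_iff']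
  intro g
  rw [← SemidirectProduct.inl_left_mul_inr_right g]
  exact N.mul_mem (hinl _) (hinr _)

/-- **Remark 1.10.** `G₁ = 𝔽_q² ⋊ SL₂(𝔽_q)` is `(q-1)/2`-quasirandom: every nontrivial
irreducible complex representation of `G₁` has degree at least `(q-1)/2`. -/
theorem G1_quasirandom (F : Type) [Field F] [Fintype F] (q : ℕ)
    (hq : q = Fintype.card F) (hodd : Odd q) :
    ∀ (V : Type) [AddCommGroup V] [Module ℂ V] [FiniteDimensional ℂ V]
      (ρ : Representation ℂ (G1 F) V), IsIrreducibleRep ρ →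
      (∃ g : G1 F, ρ g ≠ 1) → ((q : ℝ) - 1) / 2 ≤ (Module.finrank ℂ V : ℝ) := by
  intro V _ _ _ ρ _ ⟨g, hg⟩
  let ι : SL(2, F) →* G1 F := SemidirectProduct.inr
  let σ : Representation ℂ (Multiplicative F) V := ρ.comp (ι.comp (upperUnipotent F))
  obtain ⟨x, hx⟩ : ∃ x : F, σ (.ofAdd x) ≠ 1 := by
    by_contra! H
    have htop := normal_eq_top_of_inr_upperUnipotent_mem (MonoidHom.ker ρ) fun b =>
      MonoidHom.mem_ker.mpr (H b)
    exact hg (MonoidHom.mem_ker.mp (htop ▸ Subgroup.mem_top g))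
  obtain ⟨ψ, hψ, w, hw, hσ⟩ := exists_eigenvector_of_ne_one σ hx
  have hinj := AddChar.to_mulShift_inj_of_isPrimitive (AddChar.IsPrimitive.of_ne_one hψ)
  let S := Set.range fun a : Fˣ => (a : F) ^ 2
  choose a ha using fun s : S => s.2
  have hli : LinearIndependent ℂ fun s : S => ρ (ι (diagTorus (a s))) w := by
    refine linearIndependent_of_eigenvectors σ (fun s : S => AddChar.mulShift ψ s)
      (hinj.comp Subtype.val_injective) _ (fun s h => hw ?_) fun s b => ?_
    · have h' := congrArg (ρ (ι (diagTorus (a s)))⁻¹) h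
      rwa [← Module.End.mul_apply, ← map_mul, inv_mul_cancel, map_one, map_zero] at h'
    · have hb : σ (.ofAdd b) * ρ (ι (diagTorus (a s))) =
          ρ (ι (diagTorus (a s))) * σ (.ofAdd ((s : F) * b)) := by
        simp only [σ, MonoidHom.comp_apply, ← map_mul, upperUnipotent_mul_diagTorus, ← ha s]
      rw [← Module.End.mul_apply, hb, Module.End.mul_apply, hσ, map_smul, AddChar.mulShift_apply]
  have hcard : Nat.card S ≤ Module.finrank ℂ V := by
    have := Fintype.ofFinite S
    rw [Nat.card_eq_fintype_card]
    exact hli.fintype_card_le_finrank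
  have hq2 : q ≤ 2 * Module.finrank ℂ V + 1 := by
    have := card_sub_one_le_two_mul_card_range_sq F
    change _ ≤ 2 * Nat.card S at this
    omega
  have : (q : ℝ) ≤ 2 * Module.finrank ℂ V + 1 := mod_cast hq2
  linarith
end

section
/- Let G be a finite group that is D-quasirandom for some real D > 0, i.e., every nontrivial irreducible complex representation of G has degree at least D. Then for all subsets X, Y, Z ⊆ G, one has |#{(x,y) ∈ X×Y : xy ∈ Z} − |X||Y||Z|/|G|| ≤ √(|G||X||Y||Z| / D). -/
/-- A finite group `G` is `D`-quasirandom if every nontrivial irreducible complex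
representation of `G` has degree at least `D`. -/
def Quasirandom (G : Type) [Group G] (D : ℝ) : Prop :=
  ∀ (V : Type) [AddCommGroup V] [Module ℂ V] [FiniteDimensional ℂ V]
    (ρ : Representation ℂ G V), IsIrreducibleRep ρ →
    (∃ g : G, ρ g ≠ 1) → D ≤ (Module.finrank ℂ V : ℝ)

open Finset

/-- The left regular representation of a finite group on `EuclideanSpace ℂ G`. -/
noncomputable def leftTranslation (G : Type) [Group G] :
    Representation ℂ G (EuclideanSpace ℂ G) where
  toFun h :=
    { toFun := fun f => WithLp.toLp 2 fun x => f (h⁻¹ * x)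
      map_add' := fun _ _ => rfl
      map_smul' := fun _ _ => rfl }
  map_one' := by ext f x; simp
  map_mul' a b := by
    ext f x
    change f ((a * b)⁻¹ * x) = f (b⁻¹ * (a⁻¹ * x))
    rw [mul_inv_rev, mul_assoc]

/-- The operator `f ↦ (x ↦ ∑ y, g y * f (x * y))`. -/
noncomputable def rightConv {G : Type} [Group G] [Fintype G] (g : G → ℝ) :
    EuclideanSpace ℂ G →ₗ[ℂ] EuclideanSpace ℂ G where
  toFun f := WithLp.toLp 2 fun x => ∑ y, (g y : ℂ) * f (x * y)
  map_add' a b := by ext x; simp [mul_add, sum_add_distrib]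
  map_smul' c a := by ext x; simp [mul_sum, mul_left_comm]

section

variable {G : Type} [Group G]

@[simp] lemma leftTranslation_apply (h : G) (f : EuclideanSpace ℂ G) (x : G) :
    leftTranslation G h f x = f (h⁻¹ * x) := rfl

/-- A nonzero invariant subspace without nonzero fixed vectors contains an irreducible
nontrivial subrepresentation, so has dimension at least `D`. -/
lemma Quasirandom.le_finrank {D : ℝ} (hqr : Quasirandom G D) {E : Type} [AddCommGroup E]
    [Module ℂ E] [FiniteDimensional ℂ E] (ρ : Representation ℂ G E) (U : Submodule ℂ E)
    (hU : U ≠ ⊥) (hinv : ∀ g, ∀ v ∈ U, ρ g v ∈ U)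
    (hfix : ∀ v ∈ U, (∀ g, ρ g v = v) → v = 0) : D ≤ Module.finrank ℂ U := by
  obtain ⟨W, ⟨hW0, hWU, hWinv⟩, hmin⟩ := wellFounded_lt.has_min
    {W : Submodule ℂ E | W ≠ ⊥ ∧ W ≤ U ∧ ∀ g, ∀ v ∈ W, ρ g v ∈ W} ⟨U, hU, le_rfl, hinv⟩
  let σ : Representation ℂ G W :=
    { toFun := fun g => (ρ g).restrict (hWinv g)
      map_one' := by ext; simp
      map_mul' := fun a b => by ext; simp }
  have hσ (g : G) (v : W) : (σ g v : E) = ρ g v := rfl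
  have hirr : IsIrreducibleRep σ := by
    refine ⟨Submodule.nontrivial_iff_ne_bot.2 hW0, fun W' hW' => ?_⟩
    by_contra! hne
    refine hmin (W'.map W.subtype) ⟨?_, (Submodule.map_subtype_le W W').trans hWU, ?_⟩ ?_
    · exact fun h => hne.1 <|
        Submodule.map_injective_of_injective W.injective_subtype (h.trans (Submodule.map_bot _).symm)
    · rintro g _ ⟨v, hv, rfl⟩
      exact ⟨σ g v, hW' g v hv, rfl⟩
    · refine lt_of_le_of_ne (Submodule.map_subtype_le W W') fun h => hne.2 ?_
      exact Submodule.map_injective_of_injective W.injective_subtype (by simpa using h)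
  have hnontriv : ∃ g, σ g ≠ 1 := by
    by_contra! h
    obtain ⟨v, hv, hv0⟩ := Submodule.exists_mem_ne_zero_of_ne_bot hW0
    refine hv0 (hfix v (hWU hv) fun g => ?_)
    rw [← hσ g ⟨v, hv⟩, h g]; rfl
  exact (hqr W σ hirr hnontriv).trans (by exact_mod_cast Submodule.finrank_mono hWU)

variable [Fintype G]

@[simp] lemma rightConv_apply (g : G → ℝ) (f : EuclideanSpace ℂ G) (x : G) :
    rightConv g f x = ∑ y, (g y : ℂ) * f (x * y) := rfl

lemma rightConv_leftTranslation (g : G → ℝ) (h : G) (f : EuclideanSpace ℂ G) :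
    rightConv g (leftTranslation G h f) = leftTranslation G h (rightConv g f) := by
  ext x; simp [mul_assoc]

lemma inner_leftTranslation (h : G) (f v : EuclideanSpace ℂ G) :
    inner ℂ (leftTranslation G h f) v = inner ℂ f (leftTranslation G h⁻¹ v) := by
  simp only [PiLp.inner_apply, leftTranslation_apply, inv_inv]
  exact Fintype.sum_equiv (Equiv.mulLeft h⁻¹) _ _ (by simp)

/-- Bessel's inequality: the Hilbert–Schmidt norm of `rightConv g` bounds its restriction to
any orthonormal family. -/
lemma sum_norm_sq_rightConv_le (g : G → ℝ) {ι : Type*} [Fintype ι]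
    {w : ι → EuclideanSpace ℂ G} (hw : Orthonormal ℂ w) :
    ∑ i, ‖rightConv g (w i)‖ ^ 2 ≤ Fintype.card G * ∑ y, g y ^ 2 := by
  let k : G → EuclideanSpace ℂ G := fun x => WithLp.toLp 2 fun z => (g (x⁻¹ * z) : ℂ)
  have hk (x : G) (f : EuclideanSpace ℂ G) : rightConv g f x = inner ℂ (k x) f := by
    simp only [rightConv_apply, PiLp.inner_apply, k]
    exact Fintype.sum_equiv (Equiv.mulLeft x) _ _ (by simp [mul_comm])
  have hnorm (x : G) : ‖k x‖ ^ 2 = ∑ y, g y ^ 2 := by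
    rw [EuclideanSpace.norm_sq_eq]
    exact Fintype.sum_equiv (Equiv.mulLeft x⁻¹) _ _ (by simp [k])
  calc ∑ i, ‖rightConv g (w i)‖ ^ 2 = ∑ x, ∑ i, ‖inner ℂ (w i) (k x)‖ ^ 2 := by
        simp only [EuclideanSpace.norm_sq_eq, hk]
        rw [sum_comm]
        simp only [norm_inner_symm]
    _ ≤ ∑ x, ‖k x‖ ^ 2 := sum_le_sum fun x _ => hw.sum_inner_products_le (k x)
    _ = _ := by simp [hnorm]

/-- If `∑ y, g y = 0` and `G` is `D`-quasirandom, then every nonzero eigenvalue of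
`(rightConv g)† ∘ rightConv g` has multiplicity at least `D`, which bounds the operator norm. -/
lemma Quasirandom.mul_norm_sq_rightConv_le {D : ℝ} (hqr : Quasirandom G D)
    (g : G → ℝ) (hg : ∑ y, g y = 0) (f : EuclideanSpace ℂ G) :
    D * ‖rightConv g f‖ ^ 2 ≤ Fintype.card G * (∑ y, g y ^ 2) * ‖f‖ ^ 2 := by
  let S := LinearMap.toContinuousLinearMap (rightConv g)
  let A := ContinuousLinearMap.adjoint S * S
  have hA (v w : EuclideanSpace ℂ G) :
      inner ℂ (A v) w = inner ℂ (rightConv g v) (rightConv g w) :=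
    ContinuousLinearMap.adjoint_inner_left S w (S v)
  have hAre (v : EuclideanSpace ℂ G) : A.reApplyInnerSelf v = ‖rightConv g v‖ ^ 2 := by
    rw [ContinuousLinearMap.reApplyInnerSelf_apply, hA, inner_self_eq_norm_sq]
  obtain ⟨u, hu, hmax⟩ := (isCompact_sphere (0 : EuclideanSpace ℂ G) 1).exists_isMaxOn
    (NormedSpace.sphere_nonempty.2 zero_le_one) A.reApplyInnerSelf_continuous.continuousOn
  have hu1 : ‖u‖ = 1 := by simpa using hu
  set μ : ℝ := ‖rightConv g u‖ ^ 2 with hμ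
  have hAu : A u = (μ : ℂ) • u := by
    have h := (IsSelfAdjoint.star_mul_self S).eq_smul_self_of_isLocalExtrOn (x₀ := u)
      (by rw [hu1]; exact Or.inr hmax.localize)
    have hray : A.rayleighQuotient u = μ := by
      simp [ContinuousLinearMap.rayleighQuotient, hAre, hu1, hμ]
    rw [← hray]
    exact h
  have hbound (v : EuclideanSpace ℂ G) : ‖rightConv g v‖ ^ 2 ≤ μ * ‖v‖ ^ 2 := by
    rcases eq_or_ne v 0 with rfl | hv
    · simp
    have hv' : ‖v‖ ≠ 0 := norm_ne_zero_iff.2 hv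
    have h := hmax (show ((‖v‖⁻¹ : ℝ) : ℂ) • v ∈ Metric.sphere 0 1 by
      simp [norm_smul, hv'])
    simp only [Set.mem_ofPred_eq, hAre, map_smul, norm_smul, mul_pow, ← hμ] at h
    simp only [Complex.norm_real, norm_inv, norm_norm] at h
    field_simp at h
    rwa [mul_comm]
  rcases eq_or_ne μ 0 with h0 | h0
  · have h := hbound f
    rw [h0, zero_mul] at h
    rw [le_antisymm h (sq_nonneg _), mul_zero]
    positivity
  let U := Module.End.eigenspace (A : EuclideanSpace ℂ G →ₗ[ℂ] EuclideanSpace ℂ G) (μ : ℂ)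
  have hmem (v : EuclideanSpace ℂ G) : v ∈ U ↔ ∀ w,
      inner ℂ (rightConv g v) (rightConv g w) = inner ℂ ((μ : ℂ) • v) w := by
    rw [Module.End.mem_eigenspace_iff, ext_iff_inner_right ℂ]
    exact forall_congr' fun w => by rw [← hA]; rfl
  have hnorm (v : EuclideanSpace ℂ G) (hv : v ∈ U) : ‖rightConv g v‖ ^ 2 = μ * ‖v‖ ^ 2 := by
    have h := (hmem v).1 hv v
    rw [inner_smul_left, inner_self_eq_norm_sq_to_K, inner_self_eq_norm_sq_to_K,
      Complex.conj_ofReal] at h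
    simp only [Complex.coe_algebraMap] at h
    exact_mod_cast h
  have hdim : D ≤ Module.finrank ℂ U := by
    refine hqr.le_finrank (leftTranslation G) U ?_ ?_ ?_
    · intro h
      have hu0 : u ∈ U := Module.End.mem_eigenspace_iff.2 hAu
      rw [h, Submodule.mem_bot] at hu0
      simp [hu0] at hu1
    · intro h v hv
      rw [hmem] at hv ⊢
      intro w
      rw [rightConv_leftTranslation, inner_leftTranslation, ← rightConv_leftTranslation, hv,
        ← map_smul, inner_leftTranslation]
    · intro v hv hfix
      have hconst (x : G) : v x = v 1 := by
        have h := congrArg (fun w : EuclideanSpace ℂ G => w x) (hfix x)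
        simpa using h.symm
      have hzero : rightConv g v = 0 := by
        ext x
        simp [hconst, ← sum_mul, ← Complex.ofReal_sum, hg]
      simpa [hzero, h0] using (hnorm v hv).symm
  have hHS : Module.finrank ℂ U * μ ≤ Fintype.card G * ∑ y, g y ^ 2 := by
    let b := stdOrthonormalBasis ℂ U
    have h := sum_norm_sq_rightConv_le g (b.orthonormal.comp_linearIsometry U.subtypeₗᵢ)
    have hb (i) : ‖rightConv g (b i : EuclideanSpace ℂ G)‖ ^ 2 = μ := by
      rw [hnorm _ (b i).2, Submodule.norm_coe, b.orthonormal.1, one_pow, mul_one]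
    simpa [hb] using h
  have hμ0 : 0 ≤ μ := by positivity
  rcases le_or_gt D 0 with hD | hD
  · exact (mul_nonpos_of_nonpos_of_nonneg hD (sq_nonneg _)).trans (by positivity)
  calc D * ‖rightConv g f‖ ^ 2 ≤ D * (μ * ‖f‖ ^ 2) := by gcongr; exact hbound f
    _ = D * μ * ‖f‖ ^ 2 := by ring
    _ ≤ Module.finrank ℂ U * μ * ‖f‖ ^ 2 := by gcongr
    _ ≤ _ := by gcongr

end

/-- **Theorem 1.1 (Gowers).** If a finite group `G` is `D`-quasirandom, then for all
`X, Y, Z ⊆ G`,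
`|#{(x,y) ∈ X×Y : xy ∈ Z} - |X||Y||Z|/|G|| ≤ √(|G||X||Y||Z|/D)`. -/
theorem gowers_mixing {G : Type} [Group G] [Fintype G] (D : ℝ) (hD : 0 < D)
    (hqr : Quasirandom G D) (X Y Z : Set G) :
    |(Nat.card {p : G × G // p.1 ∈ X ∧ p.2 ∈ Y ∧ p.1 * p.2 ∈ Z} : ℝ) -
        (Nat.card X : ℝ) * (Nat.card Y : ℝ) * (Nat.card Z : ℝ) / (Nat.card G : ℝ)| ≤
      Real.sqrt ((Nat.card G : ℝ) * (Nat.card X : ℝ) * (Nat.card Y : ℝ) *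
        (Nat.card Z : ℝ) / D) := by
  classical
  have hcard (S : Set G) : (Nat.card S : ℝ) = ∑ x, S.indicator 1 x := by
    simp [Set.indicator_apply, Nat.card_eq_fintype_card, Fintype.card_subtype]
  have hcard_sq (S : Set G) : (Nat.card S : ℝ) = ∑ x, S.indicator (1 : G → ℝ) x ^ 2 := by
    rw [hcard]
    exact sum_congr rfl fun x _ => by by_cases hx : x ∈ S <;> simp [hx]
  have hG : (0 : ℝ) < Nat.card G := by exact_mod_cast Nat.card_pos
  set n : ℝ := (Nat.card G : ℝ) with hn
  have hn' : (Fintype.card G : ℝ) = n := by rw [hn, Nat.card_eq_fintype_card]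
  let g : G → ℝ := fun y => Y.indicator 1 y - Nat.card Y / n
  have hg : ∑ y, g y = 0 := by
    simp only [g, sum_sub_distrib, ← hcard]
    simp only [sum_const, card_univ, nsmul_eq_mul, hn']
    field_simp
    ring
  have hg_sq : ∑ y, g y ^ 2 ≤ Nat.card Y := by
    have h : ∑ y, g y ^ 2 = Nat.card Y - Nat.card Y ^ 2 / n := by
      simp only [g, sub_sq, sum_sub_distrib, sum_add_distrib, ← hcard_sq, ← sum_mul,
        ← mul_sum, ← hcard]
      simp only [sum_const, card_univ, nsmul_eq_mul, hn']
      field_simp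
      ring
    rw [h]
    exact sub_le_self _ (by positivity)
  let F : EuclideanSpace ℂ G := WithLp.toLp 2 fun x => ((Z.indicator 1 x : ℝ) : ℂ)
  let c : G → ℝ := fun x => ∑ y, g y * Z.indicator 1 (x * y)
  have hF : ‖F‖ ^ 2 = Nat.card Z := by
    rw [hcard_sq]
    simp [EuclideanSpace.norm_sq_eq, F]
  have hc : ‖rightConv g F‖ ^ 2 = ∑ x, c x ^ 2 := by
    rw [EuclideanSpace.norm_sq_eq]
    refine sum_congr rfl fun x _ => ?_
    have h : rightConv g F x = (c x : ℂ) := by simp [F, c]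
    rw [h, Complex.norm_real, Real.norm_eq_abs, sq_abs]
  have hcount : (Nat.card {p : G × G // p.1 ∈ X ∧ p.2 ∈ Y ∧ p.1 * p.2 ∈ Z} : ℝ) =
      ∑ x, X.indicator 1 x * ∑ y, Y.indicator 1 y * Z.indicator 1 (x * y) := by
    rw [Nat.card_eq_fintype_card, Fintype.card_subtype, card_filter, Fintype.sum_prod_type]
    push_cast
    refine sum_congr rfl fun x _ => ?_
    rw [mul_sum]
    refine sum_congr rfl fun y _ => ?_
    by_cases hx : x ∈ X <;> by_cases hy : y ∈ Y <;> by_cases hz : x * y ∈ Z <;> simp [hx, hy, hz]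
  have hZ (x : G) : ∑ y, Z.indicator (1 : G → ℝ) (x * y) = Nat.card Z := by
    rw [hcard]
    exact Fintype.sum_equiv (Equiv.mulLeft x) _ _ fun _ => rfl
  have hmain : (Nat.card {p : G × G // p.1 ∈ X ∧ p.2 ∈ Y ∧ p.1 * p.2 ∈ Z} : ℝ) -
      Nat.card X * Nat.card Y * Nat.card Z / n = ∑ x, X.indicator 1 x * c x := by
    simp only [hcount, c, g, sub_mul, sum_sub_distrib, ← mul_sum, hZ, mul_sub, ← sum_mul, ← hcard]
    ring
  rw [hmain]
  refine Real.abs_le_sqrt ((sum_mul_sq_le_sq_mul_sq _ _ _).trans ?_)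
  rw [← hcard_sq, ← hc, le_div_iff₀ hD]
  have h := hqr.mul_norm_sq_rightConv_le g hg F
  rw [hF, hn'] at h
  calc (Nat.card X : ℝ) * ‖rightConv g F‖ ^ 2 * D
      = Nat.card X * (D * ‖rightConv g F‖ ^ 2) := by ring
    _ ≤ Nat.card X * (n * Nat.card Y * Nat.card Z) := by
        refine mul_le_mul_of_nonneg_left (h.trans ?_) (Nat.cast_nonneg _)
        gcongr
    _ = _ := by ring
end
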